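/- Let K be a field and let J_1, J_2, J_3 be the explicit squarefree monomial ideals defined in the context, regarded as finitely generated squarefree monomial ideals of S_∞ = K[x_1, x_2, …] in 23, 24, 25 variables respectively. Then {J_1, J_2, J_3} is a generic set on the property C defined by: μ(I) = 5, pd_{K[X(I)]} K[X(I)]/(I ∩ K[X(I)]) = 3, height I = 2, and I is connected. That is: (1) each J_i satisfies C; and (2) for every finitely generated squarefree monomial ideal J of S_∞ satisfying C, with G(J) = {m_1,…,m_5}, there exist i ∈ {1,2,3}, a labeling G(J_i) = {m'_1,…,m'_5} with m'_k = x_{t_{k1}} ⋯ x_{t_{k j_k}}, and pairwise coprime (possibly trivial) squarefree monomials M_1,…,M_n in the variables X(J), where n = |X(J_i)|, such that M_{t_{k1}} ⋯ M_{t_{k j_k}} = m_k for k = 1,…,5. -/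

import Mathlib

open CategoryTheory MvPolynomial

universe u

variable (K : Type u) [Field K]

/-- The squarefree monomial with support `A` in `K[x_0, x_1, …]`. -/
noncomputable def sqfMon (A : Finset ℕ) : MvPolynomial ℕ K :=
  ∏ i ∈ A, X i

/-- `I` is a finitely generated squarefree monomial ideal of
`S_∞ = K[x_0, x_1, …]`. -/
def IsFGSqfMonIdeal (I : Ideal (MvPolynomial ℕ K)) : Prop :=
  ∃ 𝒜 : Finset (Finset ℕ), I = Ideal.span ((fun A => sqfMon K A) '' ↑𝒜)

/-- The supports of the minimal monomial generators `G(I)` of a squarefree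
monomial ideal `I`. -/
def minSupp (I : Ideal (MvPolynomial ℕ K)) : Set (Finset ℕ) :=
  {A | sqfMon K A ∈ I ∧ ∀ B : Finset ℕ, B ⊂ A → sqfMon K B ∉ I}

/-- `μ(I)`: the number of minimal monomial generators. -/
noncomputable def muI (I : Ideal (MvPolynomial ℕ K)) : ℕ :=
  (minSupp K I).ncard

/-- `X(I)`: the set of variables appearing in the minimal monomial
generators of `I`. -/
def varSet (I : Ideal (MvPolynomial ℕ K)) : Set ℕ :=
  ⋃ A ∈ minSupp K I, (↑A : Set ℕ)

/-- The hypergraph `H(I)`, with vertex set `G(I)` (identified with the set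
`minSupp K I` of supports of minimal generators): faces are the nonempty
sets of generators divisible by a fixed variable. -/
def hypI (I : Ideal (MvPolynomial ℕ K)) : Set (Set (Finset ℕ)) :=
  {F | F.Nonempty ∧ ∃ x : ℕ, F = {A ∈ minSupp K I | x ∈ A}}

/-- The relation of Definition 5.1(2): the ideal `J` is obtained from
`I ∈ 𝒜` by substituting pairwise coprime squarefree monomials `M x` (in the
variables `X(J)`, possibly trivial) for the variables `x ∈ X(I)`; on supports
this means a bijection `σ` of `G(I)` with `G(J)` such that the support of
`σ A` is the disjoint union of the `M x`, `x ∈ A`. -/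
def Connects (I J : Ideal (MvPolynomial ℕ K)) : Prop :=
  ∃ (σ : Finset ℕ → Finset ℕ) (M : ℕ → Finset ℕ),
    Set.BijOn σ (minSupp K I) (minSupp K J) ∧
    (∀ x ∈ varSet K I, ∀ y ∈ varSet K I, x ≠ y → Disjoint (M x) (M y)) ∧
    (∀ x ∈ varSet K I, (↑(M x) : Set ℕ) ⊆ varSet K J) ∧
    (∀ A ∈ minSupp K I, σ A = A.biUnion M)

/-- `𝒜` is a generic set on the property `C` (a set of ideals): every member
is a finitely generated squarefree monomial ideal satisfying `C`, and every
finitely generated squarefree monomial ideal satisfying `C` arises from some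
member of `𝒜` by the substitution relation `Connects`. -/
def IsGenericSet (C 𝒜 : Set (Ideal (MvPolynomial ℕ K))) : Prop :=
  (∀ I ∈ 𝒜, IsFGSqfMonIdeal K I ∧ I ∈ C) ∧
  (∀ J, IsFGSqfMonIdeal K J → J ∈ C → ∃ I ∈ 𝒜, Connects K I J)

/-- A generic set is minimal if no proper subset is a generic set. -/
def IsMinimalGenericSet (C 𝒜 : Set (Ideal (MvPolynomial ℕ K))) : Prop :=
  IsGenericSet K C 𝒜 ∧ ∀ 𝒜' ⊆ 𝒜, IsGenericSet K C 𝒜' → 𝒜' = 𝒜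

/-- The projective dimension (possibly `⊤`) of a module `M` over a commutative
ring `R`, via the standard characterization by vanishing of `Ext` groups. -/
noncomputable def pdim (R : Type u) [CommRing R] (M : ModuleCat.{u} R) : ℕ∞ :=
  sInf {n : ℕ∞ | ∀ k : ℕ, n < (k : ℕ∞) → ∀ N : ModuleCat.{u} R,
    Subsingleton (((Ext R (ModuleCat.{u} R) k).obj (Opposite.op M)).obj N)}

/-- `I ∩ K[X(I)]`: the restriction of `I` to the polynomial ring in the
variables appearing in its minimal generators. -/
noncomputable def restrictIdeal (I : Ideal (MvPolynomial ℕ K)) :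
    Ideal (MvPolynomial (varSet K I) K) :=
  Ideal.comap (MvPolynomial.rename (Subtype.val : varSet K I → ℕ)) I

/-- `pd_{K[X(I)]} K[X(I)]/(I ∩ K[X(I)])`. -/
noncomputable def pdRestrict (I : Ideal (MvPolynomial ℕ K)) : ℕ∞ :=
  pdim (MvPolynomial (varSet K I) K)
    (ModuleCat.of (MvPolynomial (varSet K I) K)
      (MvPolynomial (varSet K I) K ⧸ restrictIdeal K I))

/-- The height of an ideal: the infimum of the heights of the primes
containing it. -/
noncomputable def idealHeight {R : Type*} [CommRing R] (I : Ideal R) : ℕ∞ :=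
  sInf {h | ∃ p : PrimeSpectrum R, I ≤ p.asIdeal ∧ h = Order.height p}

/-- `I` is connected: any two minimal generators are linked by a chain of
minimal generators in which consecutive members share a variable. -/
def ConnectedIdeal (I : Ideal (MvPolynomial ℕ K)) : Prop :=
  ∀ A ∈ minSupp K I, ∀ B ∈ minSupp K I,
    Relation.ReflTransGen
      (fun P Q => P ∈ minSupp K I ∧ Q ∈ minSupp K I ∧ (P ∩ Q).Nonempty) A B

/-- The property `C`: `μ(I) = 5`, `pd_{K[X(I)]} K[X(I)]/(I ∩ K[X(I)]) = 3`,
`height I = 2`, and `I` is connected. -/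
def propC : Set (Ideal (MvPolynomial ℕ K)) :=
  {I | muI K I = 5 ∧ pdRestrict K I = 3 ∧ idealHeight I = 2 ∧ ConnectedIdeal K I}

/-- The ideal `J₁` (in 23 variables). -/
noncomputable def J1 : Ideal (MvPolynomial ℕ K) :=
  Ideal.span
    {sqfMon K {1, 3, 7, 8, 9, 10, 12, 14, 15, 18, 19, 20, 21, 22},
     sqfMon K {2, 4, 5, 8, 9, 11, 13, 14, 17, 18, 19, 20, 21, 23},
     sqfMon K {3, 5, 9, 11, 12, 15, 16, 17, 19, 20, 22, 23},
     sqfMon K {4, 6, 10, 11, 12, 13, 16, 18, 19, 21, 22, 23},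
     sqfMon K {6, 7, 10, 13, 14, 15, 16, 17, 20, 21, 22, 23}}

/-- The ideal `J₂` (in 24 variables). -/
noncomputable def J2 : Ideal (MvPolynomial ℕ K) :=
  Ideal.span
    {sqfMon K {1, 4, 7, 9, 10, 12, 15, 16, 18, 19, 20, 22, 23, 24},
     sqfMon K {2, 5, 8, 9, 11, 14, 15, 17, 18, 19, 21, 22, 23, 24},
     sqfMon K {3, 6, 7, 8, 11, 12, 13, 16, 17, 19, 20, 21, 23, 24},
     sqfMon K {4, 5, 10, 11, 12, 13, 14, 15, 20, 21, 22, 23},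
     sqfMon K {6, 10, 13, 14, 16, 17, 18, 20, 21, 22, 24}}

/-- The ideal `J₃` (in 25 variables). -/
noncomputable def J3 : Ideal (MvPolynomial ℕ K) :=
  Ideal.span
    {sqfMon K {1, 5, 6, 7, 11, 12, 15, 18, 19, 20, 21, 22, 23, 24},
     sqfMon K {2, 5, 8, 9, 11, 13, 15, 16, 17, 18, 21, 22, 24, 25},
     sqfMon K {3, 6, 8, 10, 12, 14, 15, 16, 17, 20, 21, 23, 24, 25},
     sqfMon K {4, 7, 9, 10, 13, 14, 17, 18, 19, 20, 22, 23, 24, 25},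
     sqfMon K {11, 12, 13, 14, 16, 19, 21, 22, 23, 25}}

lemma subsingleton_linearYonedaObj_homology_iff {R : Type u} [CommRing R] {M : ModuleCat.{u} R}
    (P : ProjectiveResolution M) (N : ModuleCat.{u} R) (n : ℕ) :
    Subsingleton ((P.complex.linearYonedaObj R N).homology (n + 1)) ↔
      Subsingleton (Abelian.Ext M N (n + 1)) := by
  rw [← ModuleCat.isZero_iff_subsingleton, ← HomologicalComplex.exactAt_iff_isZero_homology,
    HomologicalComplex.exactAt_iff' _ n (n + 1) (n + 1 + 1) (by simp) (by simp),
    ShortComplex.moduleCat_exact_iff]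
  constructor
  · intro h
    refine subsingleton_of_forall_eq 0 fun α ↦ ?_
    obtain ⟨f, hf, rfl⟩ := P.extMk_surjective α (n + 1 + 1) rfl
    rw [P.extMk_eq_zero_iff f _ rfl hf n rfl]
    exact h f hf
  · intro h f hf
    exact (P.extMk_eq_zero_iff f _ rfl hf n rfl).1 (Subsingleton.elim _ _)

lemma subsingleton_ext_iff {R : Type u} [CommRing R] (M N : ModuleCat.{u} R) (n : ℕ) :
    Subsingleton (((Ext R (ModuleCat.{u} R) (n + 1)).obj (Opposite.op M)).obj N) ↔
      Subsingleton (Abelian.Ext M N (n + 1)) := by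
  let P := projectiveResolution M
  rw [← subsingleton_linearYonedaObj_homology_iff P N n, ← ModuleCat.isZero_iff_subsingleton,
    ← ModuleCat.isZero_iff_subsingleton, (P.isoExt (n + 1) N).isZero_iff]

lemma hasProjectiveDimensionLE_of_pdim_eq {R : Type u} [CommRing R] {M : ModuleCat.{u} R} {n : ℕ}
    (h : pdim R M = n) : HasProjectiveDimensionLE M n := by
  have hmem := csInf_mem (s := {n : ℕ∞ | ∀ k : ℕ, n < (k : ℕ∞) → ∀ N : ModuleCat.{u} R,
    Subsingleton (((Ext R (ModuleCat.{u} R) k).obj (Opposite.op M)).obj N)})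
    ⟨⊤, fun k hk ↦ absurd hk (by simp)⟩
  change pdim R M ∈ _ at hmem
  rw [h] at hmem
  refine HasProjectiveDimensionLT.mk fun i hi Y e ↦ ?_
  obtain ⟨i, rfl⟩ : ∃ j, i = j + 1 := ⟨i - 1, by omega⟩
  have := (subsingleton_ext_iff M Y i).1 (hmem (i + 1) (by exact_mod_cast hi) Y)
  exact Subsingleton.elim _ _

lemma pdim_eq_of_nontrivial_ext {R : Type u} [CommRing R] {M : ModuleCat.{u} R} {n : ℕ}
    (h : HasProjectiveDimensionLE M (n + 1)) {N : ModuleCat.{u} R}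
    (hN : Nontrivial (Abelian.Ext M N (n + 1))) : pdim R M = (n + 1 : ℕ) := by
  apply le_antisymm
  · refine sInf_le fun k hk Y ↦ ?_
    have hk' : n + 1 < k := by exact_mod_cast hk
    obtain ⟨k, rfl⟩ : ∃ j, k = j + 1 := ⟨k - 1, by omega⟩
    exact (subsingleton_ext_iff M Y k).2
      (HasProjectiveDimensionLT.subsingleton M (n + 1 + 1) (k + 1) hk' Y)
  · refine le_sInf fun m hm ↦ ?_
    by_contra! hlt
    have := (subsingleton_ext_iff M N n).1 (hm (n + 1) hlt N)
    exact false_of_nontrivial_of_subsingleton (Abelian.Ext M N (n + 1))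

section ShortExact

variable {R : Type u} [CommRing R] {A B C : Type u} [AddCommGroup A] [Module R A]
  [AddCommGroup B] [Module R B] [AddCommGroup C] [Module R C]

lemma shortExact_moduleCat_ofHom {f : A →ₗ[R] B} {g : B →ₗ[R] C} (hf : Function.Injective f)
    (hfg : Function.Exact f g) (hg : Function.Surjective g) :
    (ShortComplex.mk (ModuleCat.ofHom f) (ModuleCat.ofHom g)
      (by ext x; simp [hfg.apply_apply_eq_zero])).ShortExact where
  exact := by
    rw [ShortComplex.moduleCat_exact_iff]
    exact fun x hx ↦ (hfg x).1 hx
  mono_f := (ModuleCat.mono_iff_injective _).2 hf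
  epi_g := (ModuleCat.epi_iff_surjective _).2 hg

lemma hasProjectiveDimensionLT_of_exact {f : A →ₗ[R] B} {g : B →ₗ[R] C}
    (hf : Function.Injective f) (hfg : Function.Exact f g) (hg : Function.Surjective g) {n : ℕ}
    (hA : HasProjectiveDimensionLT (ModuleCat.of R A) n)
    (hB : HasProjectiveDimensionLT (ModuleCat.of R B) (n + 1)) :
    HasProjectiveDimensionLT (ModuleCat.of R C) (n + 1) :=
  (shortExact_moduleCat_ofHom hf hfg hg).hasProjectiveDimensionLT_X₃ n hA hB

lemma nontrivial_ext_of_exact_of_hasProjectiveDimensionLT {f : A →ₗ[R] B} {g : B →ₗ[R] C}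
    (hf : Function.Injective f) (hfg : Function.Exact f g) (hg : Function.Surjective g) {n : ℕ}
    (hB : HasProjectiveDimensionLT (ModuleCat.of R B) (n + 1)) {N : ModuleCat.{u} R}
    (hC : Nontrivial (Abelian.Ext (ModuleCat.of R C) N (n + 1))) :
    Nontrivial (Abelian.Ext (ModuleCat.of R A) N n) := by
  obtain ⟨x, hx⟩ := exists_ne (0 : Abelian.Ext (ModuleCat.of R C) N (n + 1))
  obtain ⟨y, hy⟩ := Abelian.Ext.contravariant_sequence_exact₃
    (shortExact_moduleCat_ofHom hf hfg hg) N x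
    (Abelian.Ext.eq_zero_of_hasProjectiveDimensionLT _ (n + 1) le_rfl) (add_comm 1 n)
  refine nontrivial_of_ne y 0 ?_
  rintro rfl
  exact hx (by simpa using hy.symm)

lemma smul_id_eq_of_forall {N : Type u} [AddCommGroup N] [Module R N] {r : R}
    (h : ∀ x : N, r • x = x) : r • 𝟙 (ModuleCat.of R N) = 𝟙 (ModuleCat.of R N) := by
  ext x
  exact h x

lemma smul_id_eq_zero_of_forall {N : Type u} [AddCommGroup N] [Module R N] {r : R}
    (h : ∀ x : N, r • x = 0) : r • 𝟙 (ModuleCat.of R N) = 0 := by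
  ext x
  exact h x

lemma ext_smul_eq_self {M : ModuleCat.{u} R} {N : Type u} [AddCommGroup N] [Module R N] {r : R}
    (h : ∀ x : N, r • x = x) {n : ℕ} (e : Abelian.Ext M (ModuleCat.of R N) n) : r • e = e := by
  rw [Abelian.Ext.smul_eq_comp_mk₀, smul_id_eq_of_forall h, Abelian.Ext.comp_mk₀_id]

lemma ext_smul_eq_zero {M : ModuleCat.{u} R} {N : Type u} [AddCommGroup N] [Module R N] {r : R}
    (h : ∀ x : N, r • x = 0) {n : ℕ} (e : Abelian.Ext M (ModuleCat.of R N) n) : r • e = 0 := by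
  rw [Abelian.Ext.smul_eq_comp_mk₀, smul_id_eq_zero_of_forall h, Abelian.Ext.mk₀_zero,
    Abelian.Ext.comp_zero]

lemma mk₀_smul_id_comp {M N : ModuleCat.{u} R} {r : R} {n : ℕ} (e : Abelian.Ext M N n) :
    (Abelian.Ext.mk₀ (r • 𝟙 M)).comp e (zero_add n) = r • e := by
  rw [Abelian.Ext.mk₀_smul, Abelian.Ext.smul_comp, Abelian.Ext.mk₀_id_comp]

lemma ext_eq_zero_of_smul_eq_zero {N : Type u} [AddCommGroup N] [Module R N] {r : R}
    (hA : ∀ x : A, r • x = 0) (hN : ∀ x : N, r • x = x) {n : ℕ}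
    (e : Abelian.Ext (ModuleCat.of R A) (ModuleCat.of R N) n) : e = 0 := by
  rw [← ext_smul_eq_self hN e, ← mk₀_smul_id_comp, smul_id_eq_zero_of_forall hA,
    Abelian.Ext.mk₀_zero, Abelian.Ext.zero_comp]

lemma nontrivial_ext_of_exact_of_smul {f : A →ₗ[R] B} {g : B →ₗ[R] C}
    (hf : Function.Injective f) (hfg : Function.Exact f g) (hg : Function.Surjective g)
    {N : Type u} [AddCommGroup N] [Module R N] {r : R} (hA : ∀ x : A, r • x = 0)
    (hN : ∀ x : N, r • x = x) {n : ℕ}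
    (hC : Nontrivial (Abelian.Ext (ModuleCat.of R C) (ModuleCat.of R N) (n + 1))) :
    Nontrivial (Abelian.Ext (ModuleCat.of R B) (ModuleCat.of R N) (n + 1)) := by
  obtain ⟨x, hx⟩ := exists_ne (0 : Abelian.Ext (ModuleCat.of R C) (ModuleCat.of R N) (n + 1))
  refine nontrivial_of_ne ((Abelian.Ext.mk₀ (ModuleCat.ofHom g)).comp x (zero_add _)) 0 fun h ↦ ?_
  obtain ⟨y, hy⟩ := Abelian.Ext.contravariant_sequence_exact₃
    (shortExact_moduleCat_ofHom hf hfg hg) _ x h (add_comm 1 n)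
  rw [ext_eq_zero_of_smul_eq_zero hA hN y, Abelian.Ext.comp_zero] at hy
  exact hx hy.symm

lemma nontrivial_ext_succ_of_exact_lsmul {g : A →ₗ[R] C} {r : R}
    (hf : Function.Injective (LinearMap.lsmul R A r))
    (hfg : Function.Exact (LinearMap.lsmul R A r) g) (hg : Function.Surjective g)
    {N : Type u} [AddCommGroup N] [Module R N] (hN : ∀ x : N, r • x = 0) {n : ℕ}
    (hA : Nontrivial (Abelian.Ext (ModuleCat.of R A) (ModuleCat.of R N) n)) :
    Nontrivial (Abelian.Ext (ModuleCat.of R C) (ModuleCat.of R N) (n + 1)) := by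
  obtain ⟨x, hx⟩ := exists_ne (0 : Abelian.Ext (ModuleCat.of R A) (ModuleCat.of R N) n)
  have hS := shortExact_moduleCat_ofHom hf hfg hg
  refine nontrivial_of_ne (hS.extClass.comp x (add_comm 1 n)) 0 fun h ↦ ?_
  obtain ⟨y, hy⟩ := Abelian.Ext.contravariant_sequence_exact₁ hS _ x (add_comm 1 n) h
  apply hx
  rw [← hy, ← ext_smul_eq_zero hN y, ← mk₀_smul_id_comp]
  congr 1

end ShortExact

section Quotient

variable {R : Type u} [CommRing R]

lemma exact_mapQ_lsmul_factor {I I' : Ideal R} {m : R} (h : ∀ x, m * x ∈ I ↔ x ∈ I')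
    (hle : I' ≤ Submodule.comap (LinearMap.lsmul R R m) I) :
    Function.Injective (Submodule.mapQ I' I (LinearMap.lsmul R R m) hle) ∧
      Function.Exact (Submodule.mapQ I' I (LinearMap.lsmul R R m) hle)
        (Submodule.factor (le_sup_left : I ≤ I ⊔ Ideal.span {m})) := by
  have hf (x : R) : Submodule.mapQ I' I (LinearMap.lsmul R R m) hle (Submodule.Quotient.mk x) =
    Submodule.Quotient.mk (m * x) := rfl
  constructor
  · rw [injective_iff_map_eq_zero]
    intro x hx
    obtain ⟨x, rfl⟩ := Submodule.Quotient.mk_surjective _ x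
    rw [hf, Submodule.Quotient.mk_eq_zero] at hx
    exact (Submodule.Quotient.mk_eq_zero _).2 ((h x).1 hx)
  · intro y
    obtain ⟨y, rfl⟩ := Submodule.Quotient.mk_surjective _ y
    rw [show Submodule.factor (le_sup_left : I ≤ I ⊔ Ideal.span {m}) (Submodule.Quotient.mk y) =
      Submodule.Quotient.mk y from rfl, Submodule.Quotient.mk_eq_zero]
    constructor
    · intro hy
      obtain ⟨a, ha, b, hb, rfl⟩ := Submodule.mem_sup.1 hy
      obtain ⟨c, rfl⟩ := Ideal.mem_span_singleton.1 hb
      refine ⟨Submodule.Quotient.mk c, ?_⟩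
      rw [hf]
      refine (Submodule.Quotient.eq _).2 ?_
      simpa using ha
    · rintro ⟨x, hx⟩
      obtain ⟨x, rfl⟩ := Submodule.Quotient.mk_surjective _ x
      rw [hf, Submodule.Quotient.eq] at hx
      rw [← sub_sub_cancel (m * x) y]
      exact Submodule.sub_mem _ (Submodule.mem_sup_right
        (Ideal.mem_span_singleton.2 (dvd_mul_right m x))) (Submodule.mem_sup_left hx)

lemma hasProjectiveDimensionLT_quotient_sup_span_singleton {I I' : Ideal R} {m : R} {n : ℕ}
    (h : ∀ x, m * x ∈ I ↔ x ∈ I')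
    (hI : HasProjectiveDimensionLT (ModuleCat.of R (R ⧸ I)) (n + 1))
    (hI' : HasProjectiveDimensionLT (ModuleCat.of R (R ⧸ I')) n) :
    HasProjectiveDimensionLT (ModuleCat.of R (R ⧸ I ⊔ Ideal.span {m})) (n + 1) :=
  hasProjectiveDimensionLT_of_exact (exact_mapQ_lsmul_factor h fun x hx ↦ (h x).2 hx).1
    (exact_mapQ_lsmul_factor h fun x hx ↦ (h x).2 hx).2 (Submodule.factor_surjective _) hI' hI

lemma hasProjectiveDimensionLT_prod {A B : Type u} [AddCommGroup A] [Module R A]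
    [AddCommGroup B] [Module R B] {n : ℕ} (hA : HasProjectiveDimensionLT (ModuleCat.of R A) n)
    (hB : HasProjectiveDimensionLT (ModuleCat.of R B) n) :
    HasProjectiveDimensionLT (ModuleCat.of R (A × B)) n :=
  (shortExact_moduleCat_ofHom (f := LinearMap.inl R A B) (g := LinearMap.snd R A B)
    LinearMap.inl_injective .inl_snd LinearMap.snd_surjective).hasProjectiveDimensionLT_X₂ n hA hB

lemma nontrivial_ext_quotient_inf {P Q : Ideal R} {n : ℕ}
    (hP : HasProjectiveDimensionLT (ModuleCat.of R (R ⧸ P)) (n + 1))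
    (hQ : HasProjectiveDimensionLT (ModuleCat.of R (R ⧸ Q)) (n + 1)) {N : ModuleCat.{u} R}
    (h : Nontrivial (Abelian.Ext (ModuleCat.of R (R ⧸ P ⊔ Q)) N (n + 1))) :
    Nontrivial (Abelian.Ext (ModuleCat.of R (R ⧸ P ⊓ Q)) N n) := by
  let f : (R ⧸ P ⊓ Q) →ₗ[R] (R ⧸ P) × (R ⧸ Q) :=
    (Submodule.factor inf_le_left).prod (Submodule.factor inf_le_right)
  let g : (R ⧸ P) × (R ⧸ Q) →ₗ[R] (R ⧸ P ⊔ Q) :=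
    (Submodule.factor le_sup_left).comp (LinearMap.fst R _ _) -
      (Submodule.factor le_sup_right).comp (LinearMap.snd R _ _)
  have hf (x : R) : f (Submodule.Quotient.mk x) =
    (Submodule.Quotient.mk x, Submodule.Quotient.mk x) := rfl
  have hg (x y : R) : g (Submodule.Quotient.mk x, Submodule.Quotient.mk y) =
    Submodule.Quotient.mk (x - y) := rfl
  refine nontrivial_ext_of_exact_of_hasProjectiveDimensionLT (f := f) (g := g) ?_ ?_ ?_
    (hasProjectiveDimensionLT_prod hP hQ) h
  · rw [injective_iff_map_eq_zero]
    intro x hx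
    obtain ⟨x, rfl⟩ := Submodule.Quotient.mk_surjective _ x
    rw [hf, Prod.mk_eq_zero, Submodule.Quotient.mk_eq_zero, Submodule.Quotient.mk_eq_zero] at hx
    exact (Submodule.Quotient.mk_eq_zero _).2 hx
  · rintro ⟨x, y⟩
    obtain ⟨x, rfl⟩ := Submodule.Quotient.mk_surjective _ x
    obtain ⟨y, rfl⟩ := Submodule.Quotient.mk_surjective _ y
    rw [hg, Submodule.Quotient.mk_eq_zero]
    constructor
    · intro h
      obtain ⟨a, ha, b, hb, hab⟩ := Submodule.mem_sup.1 h
      refine ⟨Submodule.Quotient.mk (x - a), ?_⟩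
      rw [hf, Prod.mk.injEq, Submodule.Quotient.eq, Submodule.Quotient.eq]
      refine ⟨by simpa using ha, ?_⟩
      rwa [show x - a - y = b by linear_combination -hab]
    · rintro ⟨z, hz⟩
      obtain ⟨z, rfl⟩ := Submodule.Quotient.mk_surjective _ z
      rw [hf, Prod.mk.injEq, Submodule.Quotient.eq, Submodule.Quotient.eq] at hz
      rw [show x - y = (z - y) - (z - x) by ring]
      exact Submodule.sub_mem _ (Submodule.mem_sup_right hz.2) (Submodule.mem_sup_left hz.1)
  · intro z
    obtain ⟨z, rfl⟩ := Submodule.Quotient.mk_surjective _ z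
    exact ⟨(Submodule.Quotient.mk z, Submodule.Quotient.mk 0), by rw [hg, sub_zero]⟩

lemma nontrivial_ext_quotient_of_le {I L : Ideal R} (hIL : I ≤ L) {r : R}
    (hr : ∀ x ∈ L, r * x ∈ I) {N : Type u} [AddCommGroup N] [Module R N]
    (hN : ∀ x : N, r • x = x) {n : ℕ}
    (h : Nontrivial (Abelian.Ext (ModuleCat.of R (R ⧸ L)) (ModuleCat.of R N) (n + 1))) :
    Nontrivial (Abelian.Ext (ModuleCat.of R (R ⧸ I)) (ModuleCat.of R N) (n + 1)) := by
  refine nontrivial_ext_of_exact_of_smul (f := (LinearMap.ker (Submodule.factor hIL)).subtype)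
    (Submodule.subtype_injective _) (LinearMap.exact_subtype_ker_map _)
    (Submodule.factor_surjective hIL) ?_ hN h
  rintro ⟨x, hx⟩
  obtain ⟨x, rfl⟩ := Submodule.Quotient.mk_surjective _ x
  ext
  refine (Submodule.Quotient.mk_eq_zero _).2 (hr x ?_)
  exact (Submodule.Quotient.mk_eq_zero _).1 hx

lemma nontrivial_ext_quotient_sup_span_singleton {I : Ideal R} {m : R}
    (hm : ∀ x, m * x ∈ I ↔ x ∈ I) {N : Type u} [AddCommGroup N] [Module R N]
    (hN : ∀ x : N, m • x = 0) {n : ℕ}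
    (h : Nontrivial (Abelian.Ext (ModuleCat.of R (R ⧸ I)) (ModuleCat.of R N) n)) :
    Nontrivial (Abelian.Ext (ModuleCat.of R (R ⧸ I ⊔ Ideal.span {m})) (ModuleCat.of R N)
      (n + 1)) := by
  have hle : I ≤ Submodule.comap (LinearMap.lsmul R R m) I := fun x hx ↦ (hm x).2 hx
  have heq : Submodule.mapQ I I (LinearMap.lsmul R R m) hle =
      LinearMap.lsmul R (R ⧸ I) m := by
    ext; rfl
  have := exact_mapQ_lsmul_factor hm hle
  rw [heq] at this
  exact nontrivial_ext_succ_of_exact_lsmul this.1 this.2 (Submodule.factor_surjective _) hN h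

end Quotient

section SquarefreeIdeal

variable {σ : Type}

/-- The ideal of `K[x_i : i ∈ σ]` generated by the squarefree monomials with supports in `S`. -/
noncomputable def sqfIdeal (S : Set (Finset σ)) : Ideal (MvPolynomial σ K) :=
  Ideal.span ((fun A => ∏ i ∈ A, X i) '' S)

lemma sum_single_one_le_iff (A : Finset σ) (e : σ →₀ ℕ) :
    ∑ i ∈ A, Finsupp.single i 1 ≤ e ↔ A ⊆ e.support := by
  classical
  have h (j : σ) : (∑ i ∈ A, Finsupp.single i 1 : σ →₀ ℕ) j = if j ∈ A then 1 else 0 := by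
    rw [Finsupp.finsetSum_apply]
    simp [Finsupp.single_apply]
  rw [Finsupp.le_def]
  refine forall_congr' fun j ↦ ?_
  rw [h, Finsupp.mem_support_iff]
  split_ifs with hj <;> simp [hj, Nat.one_le_iff_ne_zero]

variable {K}

lemma prod_X_eq_monomial (A : Finset σ) :
    (∏ i ∈ A, X i : MvPolynomial σ K) = monomial (∑ i ∈ A, Finsupp.single i 1) 1 := by
  rw [monomial_sum_one]
  rfl

lemma mem_sqfIdeal {S : Set (Finset σ)} {f : MvPolynomial σ K} :
    f ∈ sqfIdeal K S ↔ ∀ e ∈ f.support, ∃ A ∈ S, A ⊆ e.support := by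
  have : ((fun A => ∏ i ∈ A, X i) '' S : Set (MvPolynomial σ K)) =
      (fun s => monomial s 1) '' ((fun A => ∑ i ∈ A, Finsupp.single i 1) '' S) := by
    simp_rw [Set.image_image, prod_X_eq_monomial]
  rw [sqfIdeal, this, mem_ideal_span_monomial_image]
  simp [sum_single_one_le_iff]

lemma prod_X_mem_sqfIdeal {S : Set (Finset σ)} {B : Finset σ} :
    (∏ i ∈ B, X i : MvPolynomial σ K) ∈ sqfIdeal K S ↔ ∃ A ∈ S, A ⊆ B := by
  classical
  rw [mem_sqfIdeal, prod_X_eq_monomial, support_monomial, if_neg one_ne_zero]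
  have : (∑ i ∈ B, Finsupp.single i 1 : σ →₀ ℕ).support = B := by
    ext j
    rw [Finsupp.mem_support_iff, Finsupp.finsetSum_apply]
    simp [Finsupp.single_apply]
  simp [this]

lemma sqfIdeal_le {S T : Set (Finset σ)} (h : ∀ A ∈ S, ∃ B ∈ T, B ⊆ A) :
    sqfIdeal K S ≤ sqfIdeal K T := by
  refine Ideal.span_le.2 ?_
  rintro _ ⟨A, hA, rfl⟩
  exact prod_X_mem_sqfIdeal.2 (h A hA)

lemma sqfIdeal_congr {S T : Set (Finset σ)}
    (h : ∀ B, (∃ A ∈ S, A ⊆ B) ↔ ∃ A ∈ T, A ⊆ B) : sqfIdeal K S = sqfIdeal K T :=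
  le_antisymm (sqfIdeal_le fun A hA ↦ (h A).1 ⟨A, hA, subset_rfl⟩)
    (sqfIdeal_le fun A hA ↦ (h A).2 ⟨A, hA, subset_rfl⟩)

lemma sqfIdeal_inf {S T U : Set (Finset σ)}
    (h : ∀ B, (∃ A ∈ U, A ⊆ B) ↔ (∃ A ∈ S, A ⊆ B) ∧ ∃ A ∈ T, A ⊆ B) :
    sqfIdeal K S ⊓ sqfIdeal K T = sqfIdeal K U := by
  ext f
  rw [Ideal.mem_inf, mem_sqfIdeal, mem_sqfIdeal, mem_sqfIdeal]
  simp only [h]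
  exact ⟨fun h e he ↦ ⟨h.1 e he, h.2 e he⟩, fun h ↦ ⟨fun e he ↦ (h e he).1, fun e he ↦ (h e he).2⟩⟩

lemma sqfIdeal_union (S T : Set (Finset σ)) :
    sqfIdeal K (S ∪ T) = sqfIdeal K S ⊔ sqfIdeal K T := by
  rw [sqfIdeal, Set.image_union, Ideal.span_union]
  rfl

lemma sqfIdeal_insert (B : Finset σ) (S : Set (Finset σ)) :
    sqfIdeal K (insert B S) = sqfIdeal K S ⊔ Ideal.span {∏ i ∈ B, X i} := by
  rw [← Set.union_singleton, sqfIdeal_union, sqfIdeal, sqfIdeal, Set.image_singleton]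

lemma sqfIdeal_empty : sqfIdeal K (∅ : Set (Finset σ)) = ⊥ := by
  rw [sqfIdeal, Set.image_empty, Ideal.span_empty]

variable [DecidableEq σ]

lemma prod_X_mul_mem_sqfIdeal {S : Set (Finset σ)} {B : Finset σ} {f : MvPolynomial σ K} :
    (∏ i ∈ B, X i) * f ∈ sqfIdeal K S ↔ f ∈ sqfIdeal K ((· \ B) '' S) := by
  have hB : (∑ i ∈ B, Finsupp.single i 1 : σ →₀ ℕ).support = B := by
    ext j
    rw [Finsupp.mem_support_iff, Finsupp.finsetSum_apply]
    simp [Finsupp.single_apply]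
  rw [mem_sqfIdeal, mem_sqfIdeal, prod_X_eq_monomial]
  simp only [Set.exists_mem_image]
  have key (A : Finset σ) (e : σ →₀ ℕ) :
      A ⊆ (∑ i ∈ B, Finsupp.single i 1 + e).support ↔ A \ B ⊆ e.support := by
    have : (∑ i ∈ B, Finsupp.single i 1 + e).support = B ∪ e.support := by
      ext j
      rw [Finset.mem_union, ← Finset.ext_iff.1 hB j]
      simp only [Finsupp.mem_support_iff, Finsupp.add_apply]
      omega
    rw [this, sdiff_le_iff]
    rfl
  constructor
  · intro h e he
    simp_rw [← key]
    refine h _ ?_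
    rw [mem_support_iff, coeff_monomial_mul, one_mul]
    exact mem_support_iff.1 he
  · intro h e he
    rw [mem_support_iff, coeff_monomial_mul'] at he
    split_ifs at he with hle
    · rw [one_mul] at he
      obtain ⟨A, hA, h⟩ := h _ (mem_support_iff.2 he)
      refine ⟨A, hA, ?_⟩
      rwa [← key, add_tsub_cancel_of_le hle] at h
    · exact absurd rfl he

/-- `PdLE L n` certifies that the quotient by the ideal generated by the squarefree monomials with
supports in `L` has projective dimension at most `n`, by adding the generators one at a time. -/
inductive PdLE {α : Type} [DecidableEq α] : List (Finset α) → ℕ → Prop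
  | nil (n : ℕ) : PdLE [] n
  | redundant {L : List (Finset α)} {n : ℕ} {B : Finset α} (h : ∃ C ∈ L, C ⊆ B) :
      PdLE L n → PdLE (B :: L) n
  | colon {L L' : List (Finset α)} {n : ℕ} {B : Finset α} (h : L'.Perm (L.map (· \ B))) :
      PdLE L (n + 1) → PdLE L' n → PdLE (B :: L) (n + 1)

lemma PdLE.map {α β : Type} [DecidableEq α] [DecidableEq β] {f : Finset α → Finset β}
    (hf : Monotone f) (hf' : ∀ A B, f (A \ B) = f A \ f B) {L : List (Finset α)} {n : ℕ}
    (h : PdLE L n) : PdLE (L.map f) n := by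
  induction h with
  | nil n => exact .nil n
  | redundant h _ ih =>
    obtain ⟨C, hC, h⟩ := h
    exact .redundant ⟨f C, List.mem_map_of_mem hC, hf h⟩ ih
  | colon h _ _ ih ih' =>
    refine .colon ?_ ih ih'
    have := h.map f
    rw [List.map_map] at this ⊢
    convert this using 2
    ext1 A
    exact (hf' _ _).symm

lemma PdLE.of_length_le {α : Type} [DecidableEq α] :
    ∀ {L : List (Finset α)} {n : ℕ}, L.length ≤ n → PdLE L n
  | [], n, _ => .nil n
  | B :: L, 0, h => by simp at h
  | B :: L, n + 1, h => .colon (.refl _) (.of_length_le (Nat.le_of_succ_le h))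
    (.of_length_le (by simpa using h))
  termination_by L => L.length

/-- A search for a derivation of `PdLE`, with fuel `m`. -/
def pdLE {α : Type} [DecidableEq α] : ℕ → List (Finset α) → ℕ → Bool
  | _, [], _ => true
  | 0, _, _ => false
  | m + 1, B :: L, n =>
    if ∃ C ∈ L, C ⊆ B then pdLE m L n
    else match n with
      | 0 => false
      | n + 1 => pdLE m L (n + 1) &&
        pdLE m ((L.map (· \ B)).insertionSort fun C D ↦ D.card ≤ C.card) n

lemma PdLE.of_pdLE {α : Type} [DecidableEq α] {m : ℕ} {L : List (Finset α)} {n : ℕ}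
    (h : pdLE m L n = true) : PdLE L n := by
  induction m generalizing L n with
  | zero => cases L with
    | nil => exact .nil n
    | cons B L => simp [pdLE] at h
  | succ m ih => cases L with
    | nil => exact .nil n
    | cons B L =>
      rw [pdLE.eq_def] at h
      simp only at h
      split_ifs at h with hB
      · exact .redundant hB (ih h)
      · cases n with
        | zero => simp at h
        | succ n =>
          rw [Bool.and_eq_true] at h
          exact .colon (List.perm_insertionSort _ _) (ih h.1) (ih h.2)

lemma PdLE.hasProjectiveDimensionLT {L : List (Finset σ)} {n : ℕ} (h : PdLE L n) :
    HasProjectiveDimensionLT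
      (ModuleCat.of (MvPolynomial σ K) (MvPolynomial σ K ⧸ sqfIdeal K {A | A ∈ L})) (n + 1) := by
  induction h with
  | nil n =>
    have : {A : Finset σ | A ∈ []} = ∅ := by simp
    rw [this, sqfIdeal_empty]
    have : Projective (ModuleCat.of (MvPolynomial σ K) (MvPolynomial σ K ⧸
        (⊥ : Ideal (MvPolynomial σ K)))) := by
      rw [← IsProjective.iff_projective]
      exact Module.Projective.of_equiv (Submodule.quotEquivOfEqBot _ rfl).symm
    exact hasProjectiveDimensionLT_of_ge _ 1 _ (by omega)
  | @redundant L n B h _ ih =>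
    have : sqfIdeal K {A | A ∈ B :: L} = sqfIdeal K {A | A ∈ L} := by
      obtain ⟨C, hC, h⟩ := h
      refine sqfIdeal_congr fun D ↦ ⟨?_, ?_⟩
      · rintro ⟨A, hA, hD⟩
        obtain rfl | hA := List.mem_cons.1 hA
        · exact ⟨C, hC, h.trans hD⟩
        · exact ⟨A, hA, hD⟩
      · rintro ⟨A, hA, hD⟩
        exact ⟨A, List.mem_cons_of_mem _ hA, hD⟩
    rwa [this]
  | @colon L L' n B h _ _ ih ih' =>
    have : {A | A ∈ B :: L} = insert B {A | A ∈ L} := by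
      ext; simp
    rw [this, sqfIdeal_insert]
    refine hasProjectiveDimensionLT_quotient_sup_span_singleton
      (fun f ↦ prod_X_mul_mem_sqfIdeal) ih ?_
    have : (· \ B) '' {A | A ∈ L} = {A | A ∈ L'} := by
      ext; simp [h.mem_iff]
    rwa [this]

lemma hasProjectiveDimensionLT_sqfIdeal (S : Finset (Finset σ)) {n : ℕ} (h : S.card ≤ n) :
    HasProjectiveDimensionLT
      (ModuleCat.of (MvPolynomial σ K) (MvPolynomial σ K ⧸ sqfIdeal K (S : Set (Finset σ))))
      (n + 1) := by
  have := (PdLE.of_length_le (L := S.toList) (n := n) (by simpa)).hasProjectiveDimensionLT (K := K)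
  rwa [show {A | A ∈ S.toList} = (S : Set (Finset σ)) by ext; simp] at this

variable (K) in
/-- The point of affine space whose coordinates vanish exactly on `Z`, as a module. -/
abbrev PointModule (Z : Finset σ) : Type _ :=
  MvPolynomial σ K ⧸ RingHom.ker (aeval (fun i ↦ if i ∈ Z then 0 else 1) :
    MvPolynomial σ K →ₐ[K] K)

instance (Z : Finset σ) : Nontrivial (PointModule K Z) :=
  Ideal.Quotient.nontrivial_iff.2 (RingHom.ker_ne_top _)

lemma X_smul_pointModule {Z : Finset σ} {i : σ} (hi : i ∈ Z) (x : PointModule K Z) :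
    (X i : MvPolynomial σ K) • x = 0 := by
  obtain ⟨x, rfl⟩ := Ideal.Quotient.mk_surjective x
  refine Ideal.Quotient.eq_zero_iff_mem.2 ?_
  simp [RingHom.mem_ker, hi]

lemma prod_X_smul_pointModule {Z B : Finset σ} (hB : Disjoint B Z) (x : PointModule K Z) :
    (∏ i ∈ B, X i : MvPolynomial σ K) • x = x := by
  obtain ⟨x, rfl⟩ := Ideal.Quotient.mk_surjective x
  refine Ideal.Quotient.eq.2 ?_
  have : ∏ i ∈ B, (if i ∈ Z then 0 else 1 : K) = 1 :=
    Finset.prod_eq_one fun i hi ↦ if_neg (Finset.disjoint_left.1 hB hi)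
  simp [RingHom.mem_ker, this]

variable (K) in
/-- The assertion that `Ext^n (R / I, N)` is nonzero, where `I` is generated by the squarefree
monomials with supports in `S` and `N` is the point module of `Z`. -/
def ExtNeZero (S : Set (Finset σ)) (Z : Finset σ) (n : ℕ) : Prop :=
  Nontrivial (Abelian.Ext (ModuleCat.of (MvPolynomial σ K) (MvPolynomial σ K ⧸ sqfIdeal K S))
    (ModuleCat.of (MvPolynomial σ K) (PointModule K Z)) n)

lemma ExtNeZero.of_inter {S : Set (Finset σ)} (hS : S.Finite) {Z : Finset σ} {n : ℕ}
    (h : ExtNeZero K ((· ∩ Z) '' S) Z (n + 1)) : ExtNeZero K S Z (n + 1) := by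
  have hle : sqfIdeal K S ≤ sqfIdeal K ((· ∩ Z) '' S) :=
    sqfIdeal_le fun A hA ↦ ⟨A ∩ Z, ⟨A, hA, rfl⟩, Finset.inter_subset_left⟩
  refine nontrivial_ext_quotient_of_le hle
    (r := ∏ i ∈ hS.toFinset.biUnion id \ Z, X i) (fun x hx ↦ ?_)
    (prod_X_smul_pointModule Finset.sdiff_disjoint) h
  rw [prod_X_mul_mem_sqfIdeal]
  refine sqfIdeal_le ?_ hx
  rintro _ ⟨A, hA, rfl⟩
  refine ⟨_, ⟨A, hA, rfl⟩, fun i hi ↦ ?_⟩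
  simp only [Finset.mem_sdiff, Finset.mem_biUnion, Set.Finite.mem_toFinset, id, not_and,
    not_not] at hi
  exact Finset.mem_inter.2 ⟨hi.1, hi.2 ⟨A, hA, hi.1⟩⟩

lemma extNeZero_singletons {Z T : Finset σ} (hT : T ⊆ Z) :
    ExtNeZero K ((fun i ↦ {i}) '' (T : Set σ)) Z T.card := by
  induction T using Finset.induction_on with
  | empty =>
    rw [ExtNeZero, Finset.coe_empty, Set.image_empty, sqfIdeal_empty, Finset.card_empty,
      Abelian.Ext.homEquiv₀.nontrivial_congr, ModuleCat.homEquiv.nontrivial_congr]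
    obtain ⟨x, hx⟩ := exists_ne (0 : PointModule K Z)
    refine nontrivial_of_ne (Submodule.liftQ ⊥ (LinearMap.toSpanSingleton _ _ x) bot_le) 0
      fun h ↦ hx ?_
    have := LinearMap.congr_fun h (Submodule.Quotient.mk 1)
    rwa [Submodule.liftQ_apply, LinearMap.toSpanSingleton_apply, one_smul] at this
  | insert i T hi ih =>
    rw [Finset.insert_subset_iff] at hT
    rw [ExtNeZero, Finset.coe_insert, Set.image_insert_eq, sqfIdeal_insert, Finset.prod_singleton,
      Finset.card_insert_of_notMem hi]
    refine nontrivial_ext_quotient_sup_span_singleton (fun f ↦ ?_) (X_smul_pointModule hT.1)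
      (ih hT.2)
    rw [← Finset.prod_singleton (fun i ↦ (X i : MvPolynomial σ K)) i, prod_X_mul_mem_sqfIdeal]
    congr! 2
    rw [Set.image_image]
    refine Set.image_congr fun j hj ↦ ?_
    rw [Finset.sdiff_singleton_eq_erase, Finset.erase_eq_of_notMem]
    rw [Finset.mem_singleton]
    rintro rfl
    exact hi hj

lemma ExtNeZero.congr {S T : Set (Finset σ)} {Z : Finset σ} {n : ℕ} (h : ExtNeZero K T Z n)
    (hST : ∀ B, (∃ A ∈ S, A ⊆ B) ↔ ∃ A ∈ T, A ⊆ B) : ExtNeZero K S Z n := by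
  rwa [ExtNeZero, sqfIdeal_congr hST]

lemma ExtNeZero.inf {S T : Finset (Finset σ)} {U : Set (Finset σ)} {Z : Finset σ} {n : ℕ}
    (h : ExtNeZero K (S ∪ T : Set (Finset σ)) Z (n + 1)) (hS : S.card ≤ n) (hT : T.card ≤ n)
    (hU : ∀ B, (∃ A ∈ U, A ⊆ B) ↔ (∃ A ∈ S, A ⊆ B) ∧ ∃ A ∈ T, A ⊆ B) :
    ExtNeZero K U Z n := by
  rw [ExtNeZero, ← sqfIdeal_inf (S := S) (T := T) (by simpa using hU)]
  rw [ExtNeZero, sqfIdeal_union] at h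
  exact nontrivial_ext_quotient_inf (hasProjectiveDimensionLT_sqfIdeal S hS)
    (hasProjectiveDimensionLT_sqfIdeal T hT) h

end SquarefreeIdeal

section Height

variable {K} {σ : Type}

lemma X_mem_sqfIdeal_singletons {T : Set σ} {i : σ} :
    (X i : MvPolynomial σ K) ∈ sqfIdeal K ((fun i ↦ {i}) '' T) ↔ i ∈ T := by
  classical
  simpa [Finset.singleton_subset_iff] using
    prod_X_mem_sqfIdeal (K := K) (S := (fun i ↦ {i}) '' T) (B := {i})

lemma isPrime_sqfIdeal_singletons (T : Set σ) :
    (sqfIdeal K ((fun i ↦ {i}) '' T)).IsPrime := by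
  classical
  let I := sqfIdeal K ((fun i ↦ {i}) '' T)
  let φ : MvPolynomial σ K →ₐ[K] MvPolynomial σ K := aeval fun i ↦ if i ∈ T then 0 else X i
  have hφ : (Ideal.Quotient.mkₐ K I).comp φ = Ideal.Quotient.mkₐ K I := by
    refine algHom_ext fun i ↦ ?_
    by_cases hi : i ∈ T
    · have : (X i : MvPolynomial σ K) ∈ I := X_mem_sqfIdeal_singletons.2 hi
      simp [φ, hi, Ideal.Quotient.eq_zero_iff_mem.2 this]
    · simp [φ, hi]
  have : I = RingHom.ker φ := by
    refine le_antisymm (Ideal.span_le.2 ?_) fun f hf ↦ ?_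
    · rintro _ ⟨_, ⟨i, hi, rfl⟩, rfl⟩
      simp [φ, hi]
    · rw [← Ideal.Quotient.eq_zero_iff_mem]
      have := AlgHom.congr_fun hφ f
      rw [AlgHom.comp_apply, (RingHom.mem_ker).1 hf, map_zero] at this
      exact this.symm
  change I.IsPrime
  rw [this]
  exact RingHom.ker_isPrime _

lemma comap_rename_sqfIdeal {S : Set (Finset σ)} {s : Set σ} [DecidablePred (· ∈ s)]
    (hS : ∀ A ∈ S, ↑A ⊆ s) :
    (sqfIdeal K S).comap (rename (Subtype.val : s → σ)) =
      sqfIdeal K (Finset.subtype (· ∈ s) '' S) := by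
  classical
  ext f
  rw [Ideal.mem_comap, mem_sqfIdeal, mem_sqfIdeal,
    support_rename_of_injective Subtype.val_injective, Finset.forall_mem_image]
  refine forall₂_congr fun e _ ↦ ?_
  rw [Set.exists_mem_image]
  refine exists_congr fun A ↦ and_congr_right fun hA ↦ ?_
  rw [Finsupp.mapDomain_support_of_injective Subtype.val_injective]
  constructor
  · intro h x hx
    obtain ⟨y, hy, hxy⟩ := Finset.mem_image.1 (h (Finset.mem_subtype.1 hx))
    rwa [← Subtype.ext hxy]
  · intro h x hx
    exact Finset.mem_image.2 ⟨⟨x, hS A hA hx⟩, h (Finset.mem_subtype.2 hx), rfl⟩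

lemma height_sqfIdeal_singletons_le (T : Finset σ) :
    Order.height (⟨_, isPrime_sqfIdeal_singletons (K := K) (T : Set σ)⟩ :
      PrimeSpectrum (MvPolynomial σ K)) ≤ T.card := by
  classical
  refine Order.height_le fun l hl ↦ ?_
  have hlt (i : Fin l.length) : ∃ f ∈ (l i.succ).asIdeal, f ∉ (l i.castSucc).asIdeal :=
    Set.exists_of_ssubset (l.step i)
  choose f hf hf' using hlt
  let s : Finset σ := T ∪ Finset.univ.biUnion fun i ↦ (f i).vars
  have hs (i : Fin l.length) : ∃ g : MvPolynomial (s : Set σ) K, rename Subtype.val g = f i := by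
    refine exists_rename_eq_of_vars_subset_range _ _ Subtype.val_injective ?_
    rw [Subtype.range_coe]
    exact_mod_cast (Finset.subset_biUnion_of_mem (fun i ↦ (f i).vars) (Finset.mem_univ i)).trans
      Finset.subset_union_right
  choose g hg using hs
  let φ : MvPolynomial (s : Set σ) K →+* MvPolynomial σ K :=
    (rename (Subtype.val : ↥(s : Set σ) → σ)).toRingHom
  have hφ (q : PrimeSpectrum (MvPolynomial σ K)) (x : MvPolynomial (s : Set σ) K) :
      x ∈ (PrimeSpectrum.comap φ q).asIdeal ↔ rename Subtype.val x ∈ q.asIdeal := Iff.rfl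
  have hstep (i : Fin l.length) : (l i.castSucc).asIdeal < (l i.succ).asIdeal := l.step i
  let l' : LTSeries (PrimeSpectrum (MvPolynomial (s : Set σ) K)) :=
    LTSeries.mk l.length (fun i ↦ PrimeSpectrum.comap φ (l i)) <| Fin.strictMono_iff_lt_succ.2
      fun i ↦ lt_of_le_of_ne (fun x hx ↦ (hφ _ x).2 ((hstep i).le ((hφ _ x).1 hx))) fun h ↦
        hf' i <| by
          have : g i ∈ (PrimeSpectrum.comap φ (l i.castSucc)).asIdeal := by
            rw [h, hφ, hg]
            exact hf i
          rwa [hφ, hg] at this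
  have hlast : l'.last.asIdeal = Ideal.span (X '' ((T.subtype (· ∈ (s : Set σ)) : Finset _) :
      Set (s : Set σ)) : Set (MvPolynomial (s : Set σ) K)) := by
    change l.last.asIdeal.comap (rename (Subtype.val : ↥(s : Set σ) → σ)) = _
    rw [hl]
    change (sqfIdeal K _).comap _ = _
    rw [comap_rename_sqfIdeal]
    · rw [sqfIdeal, Set.image_image, Set.image_image]
      congr 1
      ext x
      constructor
      · rintro ⟨i, hi, rfl⟩
        have his : i ∈ (s : Set σ) := Finset.subset_union_left hi
        refine ⟨⟨i, his⟩, by simpa using hi, ?_⟩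
        have : Finset.subtype (· ∈ (s : Set σ)) {i} = {⟨i, his⟩} := by
          ext; simp [Subtype.ext_iff]
        simp only [this, Finset.prod_singleton]
      · rintro ⟨⟨i, his⟩, hi, rfl⟩
        refine ⟨i, by simpa using hi, ?_⟩
        have : Finset.subtype (· ∈ (s : Set σ)) {i} = {⟨i, his⟩} := by
          ext; simp [Subtype.ext_iff]
        simp only [this, Finset.prod_singleton]
    · rintro _ ⟨i, hi, rfl⟩
      have : i ∈ s := Finset.subset_union_left hi
      simpa using this
  have hcard := Ideal.height_le_card_of_mem_minimalPrimes_span (p := l'.last.asIdeal)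
    ((Finset.finite_toSet (T.subtype (· ∈ (s : Set σ)))).image X) (by
      rw [← hlast, Ideal.minimalPrimes_eq_subsingleton_self]; rfl)
  rw [PrimeSpectrum.height_eq_orderHeight] at hcard
  refine (Order.length_le_height_last (p := l')).trans (hcard.trans ?_)
  refine Nat.cast_le.2 ((Set.ncard_image_le (Finset.finite_toSet _)).trans ?_)
  rw [Set.ncard_coe_finset, Finset.card_subtype]
  exact Finset.card_filter_le _ _

lemma idealHeight_le_of_forall {S : Set (Finset σ)} {T : Finset σ}
    (h : ∀ A ∈ S, ∃ i ∈ T, i ∈ A) : idealHeight (sqfIdeal K S) ≤ T.card := by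
  refine le_trans (sInf_le ?_) (height_sqfIdeal_singletons_le (K := K) T)
  refine ⟨_, sqfIdeal_le fun A hA ↦ ?_, rfl⟩
  obtain ⟨i, hi, hiA⟩ := h A hA
  exact ⟨{i}, ⟨i, hi, rfl⟩, by simpa using hiA⟩

lemma two_le_idealHeight {S : Set (Finset σ)} (hne : S.Nonempty)
    (h : ∀ i, ∃ A ∈ S, i ∉ A) : 2 ≤ idealHeight (sqfIdeal K S) := by
  refine le_sInf ?_
  rintro _ ⟨p, hp, rfl⟩
  have hmem {A : Finset σ} (hA : A ∈ S) : ∃ i ∈ A, (X i : MvPolynomial σ K) ∈ p.asIdeal :=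
    (p.isPrime.prod_mem_iff).1 (hp (Ideal.subset_span ⟨A, hA, rfl⟩))
  obtain ⟨A, hA⟩ := hne
  obtain ⟨i, -, hi⟩ := hmem hA
  obtain ⟨B, hB, hiB⟩ := h i
  obtain ⟨j, hjB, hj⟩ := hmem hB
  let q : PrimeSpectrum (MvPolynomial σ K) := ⟨_, isPrime_sqfIdeal_singletons {i}⟩
  have hq (k : σ) : X k ∈ q.asIdeal ↔ k = i := X_mem_sqfIdeal_singletons
  have hqp : q < p := by
    refine lt_of_le_of_ne ?_ fun h ↦ hiB ?_
    · change sqfIdeal K _ ≤ _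
      rw [sqfIdeal, Ideal.span_le]
      rintro _ ⟨_, ⟨k, rfl, rfl⟩, rfl⟩
      simpa using hi
    · rw [← h, hq] at hj
      rwa [← hj]
  have hbot : ⊥ < q := by
    refine bot_lt_iff_ne_bot.2 fun h ↦ X_ne_zero (R := K) i ?_
    have := (hq i).2 rfl
    rwa [h] at this
  have h₁ := Order.height_add_one_le hqp
  have h₂ := Order.height_add_one_le hbot
  calc (2 : ℕ∞) = 0 + 1 + 1 := by norm_num
    _ ≤ Order.height p := (add_le_add_left ((add_le_add_left zero_le 1).trans h₂) 1).trans h₁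

end Height

section Local

variable {K} {σ κ ι : Type} [DecidableEq σ] [Fintype κ]

lemma exists_map_subset_iff (y : κ ↪ σ) (S : Set (Finset κ)) (B : Finset σ) :
    (∃ A ∈ Finset.map y '' S, A ⊆ B) ↔ ∃ A ∈ S, A ⊆ Finset.univ.filter fun c ↦ y c ∈ B := by
  rw [Set.exists_mem_image]
  refine exists_congr fun A ↦ and_congr_right fun _ ↦ ?_
  simp [Finset.subset_iff]

lemma extNeZero_map_of_forall_nonempty (y : κ ↪ σ) {S : Finset (Finset κ)}
    (hS : ∀ B : Finset κ, (∃ A ∈ S, A ⊆ B) ↔ B.Nonempty) :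
    ExtNeZero K (Finset.map y '' (S : Set (Finset κ))) (Finset.univ.map y) (Fintype.card κ) := by
  have h := extNeZero_singletons (K := K) (subset_refl (Finset.univ.map y))
  rw [Finset.card_map, Finset.card_univ] at h
  refine h.congr fun B ↦ ?_
  rw [exists_map_subset_iff, Set.exists_mem_image]
  simp only [Finset.mem_coe, hS, Finset.Nonempty, Finset.mem_filter, Finset.mem_univ, true_and,
    Finset.mem_map, Finset.singleton_subset_iff]
  constructor
  · rintro ⟨c, hc⟩
    exact ⟨_, ⟨c, rfl⟩, hc⟩
  · rintro ⟨_, ⟨c, rfl⟩, hc⟩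
    exact ⟨c, hc⟩

variable [DecidableEq κ]

lemma ExtNeZero.map_inf (y : κ ↪ σ) {S T U : Finset (Finset κ)} {Z : Finset σ} {n : ℕ}
    (h : ExtNeZero K (Finset.map y '' ((S ∪ T : Finset (Finset κ)) : Set (Finset κ))) Z (n + 1))
    (hS : S.card ≤ n) (hT : T.card ≤ n)
    (hU : ∀ B : Finset κ, (∃ A ∈ U, A ⊆ B) ↔ (∃ A ∈ S, A ⊆ B) ∧ ∃ A ∈ T, A ⊆ B) :
    ExtNeZero K (Finset.map y '' (U : Set (Finset κ))) Z n := by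
  refine ExtNeZero.inf (S := S.image (Finset.map y)) (T := T.image (Finset.map y)) ?_
    (Finset.card_image_le.trans hS) (Finset.card_image_le.trans hT) fun B ↦ ?_
  · rwa [Finset.coe_image, Finset.coe_image, ← Set.image_union, ← Finset.coe_union]
  · simp only [← Finset.mem_coe (s := Finset.image _ _), Finset.coe_image]
    rw [exists_map_subset_iff, exists_map_subset_iff, exists_map_subset_iff]
    exact hU _

/-- The incidence structure dual to a family `F` of subsets of `ι`. -/
def dualFamily [DecidableEq ι] [Fintype ι] (F : κ → Finset ι) : Finset (Finset κ) :=
  Finset.univ.image fun k ↦ Finset.univ.filter fun c ↦ k ∈ F c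

lemma ExtNeZero.of_dualFamily [DecidableEq ι] [Fintype ι] {A : ι → Finset σ} (y : κ ↪ σ)
    {F : κ → Finset ι} (hy : ∀ c k, y c ∈ A k ↔ k ∈ F c) {n : ℕ}
    (h : ExtNeZero K (Finset.map y '' (dualFamily F : Set (Finset κ))) (Finset.univ.map y)
      (n + 1)) :
    ExtNeZero K (Set.range A) (Finset.univ.map y) (n + 1) := by
  refine ExtNeZero.of_inter (Set.finite_range A) ?_
  have : (· ∩ Finset.univ.map y) '' Set.range A =
      Finset.map y '' (dualFamily F : Set (Finset κ)) := by
    rw [dualFamily, Finset.coe_image, Finset.coe_univ, Set.image_univ, ← Set.range_comp,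
      ← Set.range_comp]
    congr 1
    ext k x
    simp only [Function.comp_apply, Finset.mem_inter, Finset.mem_map, Finset.mem_univ, true_and,
      Finset.mem_filter]
    constructor
    · rintro ⟨hx, c, rfl⟩
      exact ⟨c, (hy c k).1 hx, rfl⟩
    · rintro ⟨c, hc, rfl⟩
      exact ⟨(hy c k).2 hc, c, rfl⟩
  rwa [this]

end Local

section Supports

variable {K}

lemma mem_minSupp_sqfIdeal {S : Set (Finset ℕ)} {A : Finset ℕ} :
    A ∈ minSupp K (sqfIdeal K S) ↔ A ∈ S ∧ ∀ B ∈ S, B ⊆ A → B = A := by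
  change _ ∈ sqfIdeal K S ∧ (∀ B ⊂ A, _ ∉ sqfIdeal K S) ↔ _
  simp only [sqfMon, prod_X_mem_sqfIdeal]
  constructor
  · rintro ⟨⟨B, hB, hBA⟩, h⟩
    have key (C) (hC : C ∈ S) (hCA : C ⊆ A) : C = A := by
      by_contra hne
      exact h C (hCA.ssubset_of_ne hne) ⟨C, hC, subset_rfl⟩
    exact ⟨key B hB hBA ▸ hB, key⟩
  · rintro ⟨hA, h⟩
    refine ⟨⟨A, hA, subset_rfl⟩, ?_⟩
    rintro B hBA ⟨C, hC, hCB⟩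
    have := h C hC (hCB.trans hBA.subset)
    exact hBA.not_subset (this ▸ hCB)

lemma minSupp_sqfIdeal {S : Set (Finset ℕ)} (hS : ∀ A ∈ S, ∀ B ∈ S, B ⊆ A → B = A) :
    minSupp K (sqfIdeal K S) = S := by
  ext A
  rw [mem_minSupp_sqfIdeal]
  exact ⟨And.left, fun h ↦ ⟨h, hS A h⟩⟩

lemma sqfIdeal_minSupp {I : Ideal (MvPolynomial ℕ K)} (h : IsFGSqfMonIdeal K I) :
    sqfIdeal K (minSupp K I) = I := by
  obtain ⟨𝒜, rfl⟩ := h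
  change sqfIdeal K (minSupp K (sqfIdeal K (𝒜 : Set (Finset ℕ)))) = sqfIdeal K 𝒜
  refine sqfIdeal_congr fun B ↦ ⟨?_, ?_⟩
  · rintro ⟨A, hA, h⟩
    exact ⟨A, (mem_minSupp_sqfIdeal.1 hA).1, h⟩
  · rintro ⟨A, hA, h⟩
    obtain ⟨C, hCA, hC⟩ := 𝒜.finite_toSet.exists_le_minimal hA
    exact ⟨C, mem_minSupp_sqfIdeal.2 ⟨hC.prop, fun D hD hDC ↦ (hC.eq_of_le hD hDC).symm ▸ rfl⟩,
      subset_trans hCA h⟩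

open Classical in
lemma restrictIdeal_eq {I : Ideal (MvPolynomial ℕ K)} (h : IsFGSqfMonIdeal K I) :
    restrictIdeal K I = sqfIdeal K (Finset.subtype (· ∈ varSet K I) '' minSupp K I) := by
  rw [← comap_rename_sqfIdeal fun A hA ↦ ?_, sqfIdeal_minSupp h]
  · rfl
  · exact Set.subset_biUnion_of_mem (u := fun A : Finset ℕ ↦ (A : Set ℕ)) hA

lemma mem_varSet_iff {ι : Type} {I : Ideal (MvPolynomial ℕ K)} {A : ι → Finset ℕ}
    (hA : minSupp K I = Set.range A) {x : ℕ} : x ∈ varSet K I ↔ ∃ k, x ∈ A k := by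
  simp [varSet, hA]

open Classical in
lemma restrictIdeal_eq_range {ι : Type} {I : Ideal (MvPolynomial ℕ K)} (h : IsFGSqfMonIdeal K I)
    {A : ι → Finset ℕ} (hA : minSupp K I = Set.range A) :
    restrictIdeal K I =
      sqfIdeal K (Set.range fun k ↦ (A k).subtype (· ∈ varSet K I)) := by
  rw [restrictIdeal_eq h]
  congr 1
  ext B
  simp [hA]

end Supports

section Refutation

/-- Splitting on the literals of the first clause of `G`, check that every valuation makes all the
literals of some clause of `B` true or all the literals of some clause of `G` false. -/
def refute : ℕ → List (List ℕ) → List (List ℕ) → Bool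
  | 0, _, _ => false
  | n + 1, B, G => B.any List.isEmpty || match G with
    | [] => false
    | [] :: _ => true
    | (b :: C) :: G =>
      refute n (B.map (List.filter fun c ↦ !c == b)) (G.filter fun D ↦ !D.contains b) &&
        refute n (B.filter fun D ↦ !D.contains b)
          (((b :: C) :: G).map (List.filter fun c ↦ !c == b))

lemma exists_of_refute {h : ℕ → Prop} {n : ℕ} {B G : List (List ℕ)} (hr : refute n B G = true) :
    (∃ C ∈ B, ∀ b ∈ C, h b) ∨ ∃ C ∈ G, ∀ b ∈ C, ¬ h b := by
  induction n generalizing B G with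
  | zero => simp [refute] at hr
  | succ n ih =>
    rw [refute.eq_def, Bool.or_eq_true, List.any_eq_true] at hr
    obtain ⟨C, hC, hr⟩ | hr := hr
    · rw [List.isEmpty_iff] at hr
      subst hr
      exact .inl ⟨_, hC, by simp⟩
    · match G with
      | [] => simp at hr
      | [] :: G => exact .inr ⟨[], by simp⟩
      | (b :: C) :: G =>
        simp only [Bool.and_eq_true] at hr
        by_cases hb : h b
        · obtain ⟨D, hD, hD'⟩ | ⟨D, hD, hD'⟩ := ih hr.1
          · obtain ⟨D, hDB, rfl⟩ := List.mem_map.1 hD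
            refine .inl ⟨D, hDB, fun c hc ↦ ?_⟩
            by_cases hcb : c = b
            · rwa [hcb]
            · exact hD' c (by simp [hc, hcb])
          · exact .inr ⟨D, List.mem_cons_of_mem _ (List.mem_of_mem_filter hD), hD'⟩
        · obtain ⟨D, hD, hD'⟩ | ⟨D, hD, hD'⟩ := ih hr.2
          · exact .inl ⟨D, List.mem_of_mem_filter hD, hD'⟩
          · obtain ⟨D, hDG, rfl⟩ := List.mem_map.1 hD
            refine .inr ⟨D, hDG, fun c hc ↦ ?_⟩
            by_cases hcb : c = b
            · rwa [hcb]
            · exact hD' c (by simp [hc, hcb])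

/-- The bit mask of the image of the face `{a.1, a.2}` under the relabeling `p` of `Fin 5`. -/
def faceCode (p : List (Fin 5)) (a : Fin 5 × Fin 5) : ℕ :=
  2 ^ (p.getD a.1 0 : ℕ) ||| 2 ^ (p.getD a.2 0 : ℕ)

/-- The images of the collection of faces `t.1` under the relabelings of `Fin 5` which are
increasing along all the pairs in `t.2`. -/
def relabelings (t : List (Fin 5 × Fin 5) × List (Fin 5 × Fin 5)) : List (List ℕ) :=
  ((List.finRange 5).permutations'.filter fun p ↦
    t.2.all fun a ↦ Nat.blt (p.getD a.1 0) (p.getD a.2 0)).map fun p ↦ t.1.map (faceCode p)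

/-- Collections of faces of size at most two, each of which forces projective dimension at least
four for an ideal with five generators. -/
def forbiddenFaces : List (List (Fin 5 × Fin 5) × List (Fin 5 × Fin 5)) :=
  [([(0, 0), (1, 1), (2, 2), (3, 3), (4, 4)], [(0, 1), (1, 2), (2, 3), (3, 4)]),
    ([(0, 1), (2, 2), (3, 3), (4, 4)], [(2, 3), (3, 4)]),
    ([(0, 1), (0, 2), (3, 3), (4, 4)], [(1, 2), (3, 4)]),
    ([(0, 1), (0, 2), (0, 3), (4, 4)], [(1, 2), (2, 3)]),
    ([(0, 1), (0, 2), (0, 3), (0, 4)], [(1, 2), (2, 3), (3, 4)]),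
    ([(0, 0), (1, 3), (1, 4), (2, 3), (2, 4)], [(1, 2), (3, 4), (1, 3)]),
    ([(0, 2), (0, 3), (0, 4), (1, 2), (1, 3), (1, 4)], [(0, 1), (2, 3), (3, 4)])]

/-- The faces of size at most two which are missing from the hypergraphs of `J1`, `J2`, `J3`. -/
def missingFaces : Fin 3 → List (Fin 5 × Fin 5) × List (Fin 5 × Fin 5) :=
  ![([(2, 2), (3, 3), (4, 4), (0, 3), (2, 3), (2, 4), (1, 4)], [(0, 1)]),
    ([(3, 3), (4, 4), (0, 4), (1, 4), (3, 4), (2, 3)], [(0, 1)]),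
    ([(4, 4), (0, 4), (1, 4), (2, 4), (3, 4)], [(0, 1), (1, 2), (2, 3)])]

lemma refute_forbiddenFaces_missingFaces :
    refute 16 (forbiddenFaces.flatMap relabelings)
      ((List.finRange 3).reverse.flatMap fun i ↦ relabelings (missingFaces i)) = true := by
  decide +kernel

lemma exists_perm_of_mem_relabelings {t : List (Fin 5 × Fin 5) × List (Fin 5 × Fin 5)}
    {C : List ℕ} (hC : C ∈ relabelings t) : ∃ π : Equiv.Perm (Fin 5),
      C = t.1.map fun a ↦ 2 ^ (π a.1 : ℕ) ||| 2 ^ (π a.2 : ℕ) := by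
  obtain ⟨p, hp, rfl⟩ := List.mem_map.1 hC
  have hp := List.mem_permutations'.1 (List.mem_of_mem_filter hp)
  have hlen : p.length = 5 := by simpa using hp.length_eq
  have hnd : p.Nodup := hp.nodup_iff.2 (List.nodup_finRange 5)
  have hinj : Function.Injective fun i : Fin 5 ↦ p.getD i 0 := by
    intro i j hij
    simp only at hij
    rw [List.getD_eq_getElem _ _ (by omega), List.getD_eq_getElem _ _ (by omega),
      hnd.getElem_inj_iff] at hij
    exact Fin.ext hij
  exact ⟨Equiv.ofBijective _ (Finite.injective_iff_bijective.1 hinj), rfl⟩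

lemma exists_perm_missingFaces {h : ℕ → Prop}
    (hf : ∀ t ∈ forbiddenFaces, ∀ π : Equiv.Perm (Fin 5),
      ¬ ∀ a ∈ t.1, h (2 ^ (π a.1 : ℕ) ||| 2 ^ (π a.2 : ℕ))) :
    ∃ (i : Fin 3) (π : Equiv.Perm (Fin 5)),
      ∀ a ∈ (missingFaces i).1, ¬ h (2 ^ (π a.1 : ℕ) ||| 2 ^ (π a.2 : ℕ)) := by
  obtain ⟨C, hC, h⟩ | ⟨C, hC, h⟩ := exists_of_refute (h := h) refute_forbiddenFaces_missingFaces
  · obtain ⟨t, ht, hC⟩ := List.mem_flatMap.1 hC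
    obtain ⟨π, rfl⟩ := exists_perm_of_mem_relabelings hC
    exact absurd (List.forall_mem_map.1 h) (hf t ht π)
  · obtain ⟨i, -, hC⟩ := List.mem_flatMap.1 hC
    obtain ⟨π, rfl⟩ := exists_perm_of_mem_relabelings hC
    exact ⟨i, π, fun a ha ↦ h _ (List.mem_map_of_mem ha)⟩

end Refutation

section Obstruction

variable {σ : Type} {r : ℕ}

/-- The faces of `t`, as a family of subsets of `Fin 5`. -/
def faceFamily (t : Fin r → Fin 5 × Fin 5) (c : Fin r) : Finset (Fin 5) :=
  {(t c).1, (t c).2}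

lemma exists_embedding_of_faces {t : Fin r → Fin 5 × Fin 5} {A : Fin 5 → Finset σ}
    (hA : ∀ c, ∃ x, ∀ k, x ∈ A k ↔ k = (t c).1 ∨ k = (t c).2)
    (ht : Function.Injective (faceFamily t)) :
    ∃ y : Fin r ↪ σ, ∀ c k, y c ∈ A k ↔ k ∈ faceFamily t c := by
  choose y hy using hA
  have hy' (c : Fin r) (k : Fin 5) : y c ∈ A k ↔ k ∈ faceFamily t c := by
    rw [hy, faceFamily, Finset.mem_insert, Finset.mem_singleton]
  refine ⟨⟨y, fun c d hcd ↦ ht ?_⟩, hy'⟩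
  ext k
  rw [← hy', ← hy', hcd]

variable [DecidableEq σ]

lemma exists_extNeZero_of_nonempty {t : Fin (r + 1) → Fin 5 × Fin 5} {A : Fin 5 → Finset σ}
    (hA : ∀ c, ∃ x, ∀ k, x ∈ A k ↔ k = (t c).1 ∨ k = (t c).2)
    (ht : Function.Injective (faceFamily t))
    (h : ∀ B : Finset (Fin (r + 1)),
      (∃ C ∈ dualFamily (faceFamily t), C ⊆ B) ↔ B.Nonempty) :
    ∃ Z, ExtNeZero K (Set.range A) Z (r + 1) := by
  obtain ⟨y, hy⟩ := exists_embedding_of_faces hA ht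
  refine ⟨_, .of_dualFamily y hy ?_⟩
  simpa using extNeZero_map_of_forall_nonempty (K := K) y h

/-- A vertex and a disjoint cycle of length four. -/
def vertexSquareFaces : Fin 5 → Fin 5 × Fin 5 := ![(0, 0), (1, 3), (1, 4), (2, 3), (2, 4)]

/-- The edges of the complete bipartite graph with parts of sizes two and three. -/
def completeBipartiteFaces : Fin 6 → Fin 5 × Fin 5 :=
  ![(0, 2), (0, 3), (0, 4), (1, 2), (1, 3), (1, 4)]

lemma exists_extNeZero_of_vertexSquareFaces {A : Fin 5 → Finset σ}
    (hA : ∀ c, ∃ x, ∀ k, x ∈ A k ↔ k = (vertexSquareFaces c).1 ∨ k = (vertexSquareFaces c).2) :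
    ∃ Z, ExtNeZero K (Set.range A) Z 4 := by
  obtain ⟨y, hy⟩ := exists_embedding_of_faces hA (by decide)
  refine ⟨_, .of_dualFamily y hy ?_⟩
  refine ExtNeZero.map_inf y (S := {{0}, {1}, {4}}) (T := {{0}, {2}, {3}})
    ?_ (by decide) (by decide) (by decide +kernel)
  exact extNeZero_map_of_forall_nonempty (K := K) y (by decide +kernel)

lemma exists_extNeZero_of_completeBipartiteFaces {A : Fin 5 → Finset σ}
    (hA : ∀ c, ∃ x, ∀ k,
      x ∈ A k ↔ k = (completeBipartiteFaces c).1 ∨ k = (completeBipartiteFaces c).2) :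
    ∃ Z, ExtNeZero K (Set.range A) Z 4 := by
  obtain ⟨y, hy⟩ := exists_embedding_of_faces hA (by decide)
  refine ⟨_, .of_dualFamily y hy ?_⟩
  refine ExtNeZero.map_inf y (S := {{0}, {1, 4}, {4, 5}, {2, 5}})
    (T := {{3}, {1, 4}, {1, 2}, {2, 5}}) ?_ (by decide) (by decide) (by decide +kernel)
  refine ExtNeZero.map_inf y (S := {{0}, {3}, {1}, {5}})
    (T := {{0}, {3}, {4}, {2}}) ?_ (by decide) (by decide) (by decide +kernel)
  exact extNeZero_map_of_forall_nonempty (K := K) y (by decide +kernel)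

lemma exists_extNeZero_of_forbiddenFaces {t : List (Fin 5 × Fin 5) × List (Fin 5 × Fin 5)}
    (ht : t ∈ forbiddenFaces) {A : Fin 5 → Finset σ}
    (hA : ∀ a ∈ t.1, ∃ x, ∀ k, x ∈ A k ↔ k = a.1 ∨ k = a.2) :
    ∃ n ≥ 4, ∃ Z, ExtNeZero K (Set.range A) Z n := by
  simp only [forbiddenFaces, List.mem_cons, List.not_mem_nil, or_false] at ht
  obtain rfl | rfl | rfl | rfl | rfl | rfl | rfl := ht
  · exact ⟨5, by norm_num, exists_extNeZero_of_nonempty K (r := 4)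
      (fun c ↦ hA (![(0, 0), (1, 1), (2, 2), (3, 3), (4, 4)] c) (by revert c; decide))
      (by decide) (by decide +kernel)⟩
  · exact ⟨4, le_rfl, exists_extNeZero_of_nonempty K (r := 3)
      (fun c ↦ hA (![(0, 1), (2, 2), (3, 3), (4, 4)] c) (by revert c; decide))
      (by decide) (by decide +kernel)⟩
  · exact ⟨4, le_rfl, exists_extNeZero_of_nonempty K (r := 3)
      (fun c ↦ hA (![(0, 1), (0, 2), (3, 3), (4, 4)] c) (by revert c; decide))
      (by decide) (by decide +kernel)⟩
  · exact ⟨4, le_rfl, exists_extNeZero_of_nonempty K (r := 3)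
      (fun c ↦ hA (![(0, 1), (0, 2), (0, 3), (4, 4)] c) (by revert c; decide))
      (by decide) (by decide +kernel)⟩
  · exact ⟨4, le_rfl, exists_extNeZero_of_nonempty K (r := 3)
      (fun c ↦ hA (![(0, 1), (0, 2), (0, 3), (0, 4)] c) (by revert c; decide))
      (by decide) (by decide +kernel)⟩
  · exact ⟨4, le_rfl, exists_extNeZero_of_vertexSquareFaces K
      fun c ↦ hA (vertexSquareFaces c) (by revert c; decide)⟩
  · exact ⟨4, le_rfl, exists_extNeZero_of_completeBipartiteFaces K
      fun c ↦ hA (completeBipartiteFaces c) (by revert c; decide)⟩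

end Obstruction

section GenericSet

/-- The supports of the generators of `J1`, `J2`, `J3`. -/
def genericSupports : Fin 3 → Fin 5 → Finset ℕ :=
  ![![{1, 3, 7, 8, 9, 10, 12, 14, 15, 18, 19, 20, 21, 22},
      {2, 4, 5, 8, 9, 11, 13, 14, 17, 18, 19, 20, 21, 23},
      {3, 5, 9, 11, 12, 15, 16, 17, 19, 20, 22, 23},
      {4, 6, 10, 11, 12, 13, 16, 18, 19, 21, 22, 23},
      {6, 7, 10, 13, 14, 15, 16, 17, 20, 21, 22, 23}],
    ![{1, 4, 7, 9, 10, 12, 15, 16, 18, 19, 20, 22, 23, 24},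
      {2, 5, 8, 9, 11, 14, 15, 17, 18, 19, 21, 22, 23, 24},
      {3, 6, 7, 8, 11, 12, 13, 16, 17, 19, 20, 21, 23, 24},
      {4, 5, 10, 11, 12, 13, 14, 15, 20, 21, 22, 23},
      {6, 10, 13, 14, 16, 17, 18, 20, 21, 22, 24}],
    ![{1, 5, 6, 7, 11, 12, 15, 18, 19, 20, 21, 22, 23, 24},
      {2, 5, 8, 9, 11, 13, 15, 16, 17, 18, 21, 22, 24, 25},
      {3, 6, 8, 10, 12, 14, 15, 16, 17, 20, 21, 23, 24, 25},
      {4, 7, 9, 10, 13, 14, 17, 18, 19, 20, 22, 23, 24, 25},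
      {11, 12, 13, 14, 16, 19, 21, 22, 23, 25}]]

lemma sqfIdeal_range_fin_five (A B C D E : Finset ℕ) : sqfIdeal K (Set.range ![A, B, C, D, E]) =
    Ideal.span {sqfMon K A, sqfMon K B, sqfMon K C, sqfMon K D, sqfMon K E} := by
  rw [sqfIdeal, ← Set.range_comp]
  congr 1
  ext f
  simp [Fin.exists_fin_succ, sqfMon, eq_comm]

lemma J1_eq_sqfIdeal : J1 K = sqfIdeal K (Set.range (genericSupports 0)) :=
  (sqfIdeal_range_fin_five K _ _ _ _ _).symm

lemma J2_eq_sqfIdeal : J2 K = sqfIdeal K (Set.range (genericSupports 1)) :=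
  (sqfIdeal_range_fin_five K _ _ _ _ _).symm

lemma J3_eq_sqfIdeal : J3 K = sqfIdeal K (Set.range (genericSupports 2)) :=
  (sqfIdeal_range_fin_five K _ _ _ _ _).symm

variable {K}

lemma isFGSqfMonIdeal_sqfIdeal_range {ι : Type} [Fintype ι] (B : ι → Finset ℕ) :
    IsFGSqfMonIdeal K (sqfIdeal K (Set.range B)) := by
  refine ⟨Finset.univ.image B, ?_⟩
  rw [Finset.coe_image, Finset.coe_univ, Set.image_univ]
  rfl

lemma minSupp_sqfIdeal_range {ι : Type} {B : ι → Finset ℕ} (hB : ∀ i j, B i ⊆ B j → i = j) :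
    minSupp K (sqfIdeal K (Set.range B)) = Set.range B := by
  refine minSupp_sqfIdeal ?_
  rintro _ ⟨i, rfl⟩ _ ⟨j, rfl⟩ h
  rw [hB _ _ h]

lemma pdRestrict_sqfIdeal_range {B : Fin 5 → Finset ℕ} (hB : ∀ i j, B i ⊆ B j → i = j)
    (hpd : PdLE ((List.finRange 5).map B) 3)
    (hy : ∀ c : Fin 3, ∃ x, ∀ k,
      x ∈ B k ↔ k ∈ (![{0}, {1}, {2, 3, 4}] : Fin 3 → Finset (Fin 5)) c) :
    pdRestrict K (sqfIdeal K (Set.range B)) = 3 := by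
  classical
  have hmin := minSupp_sqfIdeal_range (K := K) hB
  rw [pdRestrict, restrictIdeal_eq_range (isFGSqfMonIdeal_sqfIdeal_range B) hmin]
  set V := varSet K (sqfIdeal K (Set.range B)) with hV
  obtain ⟨y, hy⟩ : ∃ y : Fin 3 ↪ V, ∀ c k, y c ∈ (B k).subtype (· ∈ V) ↔
      k ∈ (![{0}, {1}, {2, 3, 4}] : Fin 3 → Finset (Fin 5)) c := by
    choose y hy using hy
    have hyV (c : Fin 3) : y c ∈ V := by
      obtain ⟨k, hk⟩ : ∃ k, k ∈ (![{0}, {1}, {2, 3, 4}] : Fin 3 → Finset (Fin 5)) c := by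
        revert c; decide
      exact (mem_varSet_iff hmin).2 ⟨k, (hy c k).2 hk⟩
    refine ⟨⟨fun c ↦ ⟨y c, hyV c⟩, fun c d hcd ↦ ?_⟩, fun c k ↦ ?_⟩
    · refine (by decide : Function.Injective (![{0}, {1}, {2, 3, 4}] : Fin 3 → Finset (Fin 5))) ?_
      ext k
      rw [← hy, ← hy, Subtype.mk.inj hcd]
    · rw [Finset.mem_subtype]
      exact hy c k
  refine pdim_eq_of_nontrivial_ext (n := 2) ?_
    (ExtNeZero.of_dualFamily y hy (extNeZero_map_of_forall_nonempty y (by decide +kernel)))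
  have := (hpd.map (f := Finset.subtype (· ∈ V)) (Finset.subtype_mono)
    fun _ _ ↦ by ext; simp).hasProjectiveDimensionLT (K := K)
  rw [List.map_map] at this
  rwa [show {C | C ∈ (List.finRange 5).map (Finset.subtype (· ∈ V) ∘ B)} =
    Set.range fun k ↦ (B k).subtype (· ∈ V) by ext; simp] at this

lemma sqfIdeal_range_mem_propC {B : Fin 5 → Finset ℕ} (hB : ∀ i j, B i ⊆ B j → i = j)
    (hpd : PdLE ((List.finRange 5).map B) 3)
    (hy : ∀ c : Fin 3, ∃ x, ∀ k,
      x ∈ B k ↔ k ∈ (![{0}, {1}, {2, 3, 4}] : Fin 3 → Finset (Fin 5)) c)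
    {T : Finset ℕ} (hT : T.card ≤ 2) (hBT : ∀ k, ∃ i ∈ T, i ∈ B k)
    (hvar : ∀ i ∈ B 0, ∃ k, i ∉ B k) (hconn : ∀ i j, (B i ∩ B j).Nonempty) :
    sqfIdeal K (Set.range B) ∈ propC K := by
  have hmin := minSupp_sqfIdeal_range (K := K) hB
  refine ⟨?_, pdRestrict_sqfIdeal_range hB hpd hy, le_antisymm ?_ ?_, ?_⟩
  · rw [muI, hmin, ← Set.image_univ,
      Set.ncard_image_of_injective _ fun i j h ↦ hB i j h.subset, Set.ncard_univ, Nat.card_fin]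
  · exact (idealHeight_le_of_forall (Set.forall_mem_range.2 hBT)).trans (by exact_mod_cast hT)
  · refine two_le_idealHeight (Set.range_nonempty B) fun i ↦ Set.exists_range_iff.2 ?_
    by_cases hi : i ∈ B 0
    · exact hvar i hi
    · exact ⟨0, hi⟩
  · rw [ConnectedIdeal, hmin]
    rintro _ ⟨i, rfl⟩ _ ⟨j, rfl⟩
    exact .single ⟨⟨i, rfl⟩, ⟨j, rfl⟩, hconn i j⟩

lemma sqfIdeal_genericSupports_mem_propC (i : Fin 3) :
    sqfIdeal K (Set.range (genericSupports i)) ∈ propC K := by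
  refine sqfIdeal_range_mem_propC (T := (![{8, 16}, {9, 13}, {5, 14}] : Fin 3 → Finset ℕ) i)
    ?_ (PdLE.of_pdLE (m := 10) ?_) (fun c ↦ ?_) ?_ ?_ ?_ ?_
  · revert i; decide +kernel
  · revert i; decide +kernel
  · refine ⟨(![![1, 2, 16], ![1, 2, 13], ![1, 2, 14]] : Fin 3 → Fin 3 → ℕ) i c, ?_⟩
    revert i c; decide +kernel
  · revert i; decide +kernel
  · revert i; decide +kernel
  · revert i; decide +kernel
  · revert i; decide +kernel

lemma connects_of_faces {I J : Ideal (MvPolynomial ℕ K)} {ι : Type} [Finite ι]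
    {B A : ι → Finset ℕ}
    (hI : minSupp K I = Set.range B) (hJ : minSupp K J = Set.range A)
    (hB : Function.Injective B) (hA : Function.Injective A)
    (hvar : ∀ x ∈ varSet K I, ∀ y ∈ varSet K I, (∀ k, x ∈ B k ↔ y ∈ B k) → x = y)
    (h : ∀ y ∈ varSet K J, ∃ x, ∀ k, x ∈ B k ↔ y ∈ A k) : Connects K I J := by
  classical
  have hfin : (varSet K J).Finite := by
    refine (Set.finite_iUnion fun k ↦ (A k).finite_toSet).subset fun x hx ↦ ?_
    exact Set.mem_iUnion.2 ((mem_varSet_iff hJ).1 hx)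
  refine ⟨Function.extend B A id,
    fun x ↦ hfin.toFinset.filter fun y ↦ ∀ k, x ∈ B k ↔ y ∈ A k, ?_, ?_, ?_, ?_⟩
  · rw [hI, hJ, ← Set.image_univ, ← Set.image_univ]
    refine ⟨?_, ?_, ?_⟩
    · rintro _ ⟨k, -, rfl⟩
      rw [hB.extend_apply]
      exact ⟨k, trivial, rfl⟩
    · rintro _ ⟨k, -, rfl⟩ _ ⟨l, -, rfl⟩ hkl
      rw [hB.extend_apply, hB.extend_apply] at hkl
      rw [hA hkl]
    · rintro _ ⟨k, -, rfl⟩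
      exact ⟨B k, ⟨k, trivial, rfl⟩, hB.extend_apply _ _ _⟩
  · intro x hx y hy hxy
    rw [Finset.disjoint_left]
    intro z hz hz'
    rw [Finset.mem_filter] at hz hz'
    exact hxy (hvar x hx y hy fun k ↦ (hz.2 k).trans (hz'.2 k).symm)
  · intro x _ y hy
    exact hfin.mem_toFinset.1 (Finset.mem_filter.1 hy).1
  · rw [hI]
    rintro _ ⟨k, rfl⟩
    ext y
    rw [hB.extend_apply, Finset.mem_biUnion]
    constructor
    · intro hy
      have hyJ := (mem_varSet_iff hJ).2 ⟨k, hy⟩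
      obtain ⟨x, hx⟩ := h y hyJ
      exact ⟨x, (hx k).2 hy, Finset.mem_filter.2 ⟨hfin.mem_toFinset.2 hyJ, hx⟩⟩
    · rintro ⟨x, hx, hy⟩
      exact ((Finset.mem_filter.1 hy).2 k).1 hx

lemma not_faces_of_pdRestrict {J : Ideal (MvPolynomial ℕ K)} (hJ : IsFGSqfMonIdeal K J)
    (hpd : pdRestrict K J = 3) {A : Fin 5 → Finset ℕ} (hA : minSupp K J = Set.range A)
    {t : List (Fin 5 × Fin 5) × List (Fin 5 × Fin 5)} (ht : t ∈ forbiddenFaces) :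
    ¬ ∀ a ∈ t.1, ∃ x, ∀ k, x ∈ A k ↔ k = a.1 ∨ k = a.2 := by
  classical
  intro h
  rw [pdRestrict, restrictIdeal_eq_range hJ hA] at hpd
  obtain ⟨n, hn, Z, hZ⟩ := exists_extNeZero_of_forbiddenFaces K ht
    (A := fun k ↦ (A k).subtype (· ∈ varSet K J)) fun a ha ↦ by
      obtain ⟨x, hx⟩ := h a ha
      exact ⟨⟨x, (mem_varSet_iff hA).2 ⟨a.1, (hx _).2 (.inl rfl)⟩⟩, fun k ↦ by
        rw [Finset.mem_subtype]; exact hx k⟩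
  have := hasProjectiveDimensionLE_of_pdim_eq (n := 3) hpd
  exact not_subsingleton_iff_nontrivial.2 hZ (HasProjectiveDimensionLT.subsingleton _ 4 n hn _)

lemma exists_connects {J : Ideal (MvPolynomial ℕ K)} (hJ : IsFGSqfMonIdeal K J)
    (hC : J ∈ propC K) : ∃ i, Connects K (sqfIdeal K (Set.range (genericSupports i))) J := by
  obtain ⟨hmu, hpd, hht, -⟩ := hC
  obtain ⟨A, hAi, hA⟩ : ∃ A : Fin 5 → Finset ℕ, Function.Injective A ∧
      minSupp K J = Set.range A := by
    have hfin : (minSupp K J).Finite := Set.finite_of_ncard_pos (by rw [← muI, hmu]; norm_num)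
    have := hfin.fintype
    have e : Fin 5 ≃ minSupp K J := (Fintype.equivFinOfCardEq (by
      rw [← Nat.card_eq_fintype_card]; exact hmu)).symm
    exact ⟨fun k ↦ e k, Subtype.val_injective.comp e.injective, by
      rw [← Function.comp_def, Set.range_comp, e.range_eq_univ, Set.image_univ, Subtype.range_coe]⟩
  have hface (π : Equiv.Perm (Fin 5)) (a : Fin 5 × Fin 5) :
      (∃ x, ∀ k : Fin 5, x ∈ A k ↔ (2 ^ (π a.1 : ℕ) ||| 2 ^ (π a.2 : ℕ)).testBit k) ↔
        ∃ x, ∀ k, x ∈ A (π k) ↔ k = a.1 ∨ k = a.2 := by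
    refine exists_congr fun x ↦ ?_
    rw [← π.forall_congr_right]
    refine forall_congr' fun k ↦ iff_congr .rfl ?_
    simp only [Nat.testBit_or, Nat.testBit_two_pow, Fin.val_inj, Bool.or_eq_true, decide_eq_true_eq,
      π.injective.eq_iff, eq_comm (b := k)]
  have hAπ (π : Equiv.Perm (Fin 5)) : minSupp K J = Set.range (A ∘ π) := by
    rw [hA, π.surjective.range_comp]
  obtain ⟨i, π, hπ⟩ := exists_perm_missingFaces
    (h := fun n ↦ ∃ x, ∀ k : Fin 5, x ∈ A k ↔ n.testBit k) fun t ht π h ↦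
      not_faces_of_pdRestrict hJ hpd (hAπ π) ht fun a ha ↦ (hface π a).1 (h a ha)
  simp only [hface] at hπ
  have hB (i : Fin 3) : ∀ k l, genericSupports i k ⊆ genericSupports i l → k = l := by
    revert i; decide +kernel
  have hmin := minSupp_sqfIdeal_range (K := K) (hB i)
  refine ⟨i, connects_of_faces hmin (hAπ π) (fun k l h ↦ hB i k l h.subset)
    (hAi.comp π.injective) ?_ fun y hy ↦ ?_⟩
  · simp only [mem_varSet_iff hmin]
    have key (i : Fin 3) : ∀ k, ∀ x ∈ genericSupports i k, ∀ l, ∀ y ∈ genericSupports i l,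
        (∀ m, x ∈ genericSupports i m ↔ y ∈ genericSupports i m) → x = y := by
      revert i; decide +kernel
    rintro x ⟨k, hx⟩ y ⟨l, hy⟩
    exact key i k x hx l y hy
  · have key (i : Fin 3) : ∀ F : Finset (Fin 5), F.Nonempty → F ≠ Finset.univ →
        (∀ a ∈ (missingFaces i).1, F ≠ {a.1, a.2}) →
        ∃ l, ∃ x ∈ genericSupports i l, ∀ k, x ∈ genericSupports i k ↔ k ∈ F := by
      revert i; decide +kernel
    have hne : (Finset.univ.filter fun k ↦ y ∈ A (π k)).Nonempty := by
      obtain ⟨k, hk⟩ := (mem_varSet_iff (hAπ π)).1 hy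
      exact ⟨k, by simpa using hk⟩
    have huniv : (Finset.univ.filter fun k ↦ y ∈ A (π k)) ≠ Finset.univ := by
      intro h
      have := idealHeight_le_of_forall (K := K) (S := minSupp K J) (T := {y}) (by
        rw [hAπ π]
        rintro _ ⟨k, rfl⟩
        exact ⟨y, by simp, by simpa using Finset.ext_iff.1 h k⟩)
      rw [sqfIdeal_minSupp hJ, hht] at this
      exact absurd this (by simp)
    obtain ⟨-, x, -, hx⟩ := key i _ hne huniv fun a ha h ↦
      hπ a ha ⟨y, fun k ↦ by simpa using Finset.ext_iff.1 h k⟩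
    exact ⟨x, by simpa using hx⟩

end GenericSet

/-!
Statement 15 (Theorem `claim:result`): `{J₁, J₂, J₃}` is a generic set on the
property `C : μ(I) = 5`, `pd_{K[X(I)]} K[X(I)]/(I ∩ K[X(I)]) = 3`,
`height I = 2`, `I` connected.
-/

theorem J1_J2_J3_generic_set :
    IsGenericSet K (propC K) {J1 K, J2 K, J3 K} := by
  constructor
  · rintro I (rfl | rfl | rfl)
    · rw [J1_eq_sqfIdeal]
      exact ⟨isFGSqfMonIdeal_sqfIdeal_range _, sqfIdeal_genericSupports_mem_propC 0⟩
    · rw [J2_eq_sqfIdeal]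
      exact ⟨isFGSqfMonIdeal_sqfIdeal_range _, sqfIdeal_genericSupports_mem_propC 1⟩
    · rw [J3_eq_sqfIdeal]
      exact ⟨isFGSqfMonIdeal_sqfIdeal_range _, sqfIdeal_genericSupports_mem_propC 2⟩
  · intro J hJ hC
    obtain ⟨i, hi⟩ := exists_connects hJ hC
    fin_cases i
    · exact ⟨J1 K, by simp, by rwa [J1_eq_sqfIdeal]⟩
    · exact ⟨J2 K, by simp, by rwa [J2_eq_sqfIdeal]⟩
    · exact ⟨J3 K, by simp, by rwa [J3_eq_sqfIdeal]⟩
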